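/- Let N ∈ {1,2,3,4}, let k be a positive even integer, and let (a_n) be complex numbers with a_n = O(n^C) for some C > 0. Suppose the Dirichlet series F(s) = Σ_{n≥1} a_n n^{−s} satisfies a functional equation of degree 2, level N, and weight k, i.e. Φ(s) = (√N/(2π))^s Γ(s) F(s) extends to an entire function, bounded in every vertical strip, with Φ(s) = ε(−1)^{k/2} Φ(k−s) for some ε ∈ {+1,−1}. Then the function f(z) = Σ_{n≥1} a_n e^{2πinz} on the upper half-plane satisfies f|_k γ = f for every γ ∈ Γ₀(N). (Hecke's converse theorem.) -/

import Mathlib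

open UpperHalfPlane Matrix Complex MatrixGroups Asymptotics Filter Topology
open scoped Manifold

set_option synthInstance.maxHeartbeats 1000000 in
/-- Action of a real 2×2 matrix with positive determinant on the upper
half-plane `ℍ` (junk value `z` if the determinant is not positive). -/
noncomputable def glAct (γ : Matrix (Fin 2) (Fin 2) ℝ) (z : ℍ) : ℍ :=
  if h : 0 < γ.det then
    (⟨Matrix.GeneralLinearGroup.mkOfDetNeZero γ h.ne', by
        simpa [Matrix.GeneralLinearGroup.mkOfDetNeZero] using h⟩ : GL(2, ℝ)⁺) • z
  else z

/-- For an even integer `k`, the weight-`k` slash action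
`(f ∣ₖ γ)(z) = (det γ)^(k/2) (cz+d)^(-k) f(γz)`. -/
noncomputable def slash (k : ℤ) (γ : Matrix (Fin 2) (Fin 2) ℝ) (f : ℍ → ℂ) : ℍ → ℂ :=
  fun z => (γ.det : ℂ) ^ (k / 2) * (γ 1 0 * (z : ℂ) + γ 1 1) ^ (-k) * f (glAct γ z)

/-- An element of `SL(2, ℤ)` as a real matrix. -/
def sl2ToReal (γ : Matrix.SpecialLinearGroup (Fin 2) ℤ) : Matrix (Fin 2) (Fin 2) ℝ :=
  (γ : Matrix (Fin 2) (Fin 2) ℤ).map (Int.cast)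

/-- The function `f(z) = Σ_{n ≥ 1} a_n e^{2πinz}` on the upper half-plane. -/
noncomputable def fourierSeries (a : ℕ → ℂ) : ℍ → ℂ :=
  fun z => ∑' n : ℕ, a (n + 1) *
    Complex.exp (2 * (Real.pi : ℂ) * Complex.I * ((n : ℂ) + 1) * (z : ℂ))

/-- The Dirichlet series `F(s) = Σ_{n ≥ 1} a_n n^{-s}`. -/
noncomputable def dirichletSeries (a : ℕ → ℂ) (s : ℂ) : ℂ :=
  ∑' n : ℕ, a (n + 1) / ((n : ℂ) + 1) ^ s

/-- The action of the Hecke operator `T_p` in weight `k`: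
`f|_k T_p = f|_k ((p,0),(0,1)) + Σ_{b=0}^{p-1} f|_k ((1,b),(0,p))`. -/
noncomputable def heckeT (k : ℤ) (p : ℕ) (f : ℍ → ℂ) : ℍ → ℂ :=
  fun z => slash k !![(p : ℝ), 0; 0, 1] f z +
    ∑ b ∈ Finset.range p, slash k !![1, (b : ℝ); 0, (p : ℝ)] f z

/-- The action of the Atkin–Lehner operator `U_q` in weight `k`:
`f|_k U_q = Σ_{b=0}^{q-1} f|_k ((q,b),(0,q))`. -/
noncomputable def atkinLehnerU (k : ℤ) (q : ℕ) (f : ℍ → ℂ) : ℍ → ℂ :=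
  fun z => ∑ b ∈ Finset.range q, slash k !![(q : ℝ), (b : ℝ); 0, (q : ℝ)] f z

/-- The local factor at the prime `p` of an Euler product of degree 2,
level `N`, and weight `k`. -/
noncomputable def localFactor (a : ℕ → ℂ) (N : ℕ) (k : ℤ) (p : ℕ) (s : ℂ) : ℂ :=
  if p ∣ N then
    (if p ^ 2 ∣ N then 1 else (1 - (p : ℂ) ^ ((k : ℂ) / 2 - 1 - s))⁻¹)
  else (1 - a p * (p : ℂ) ^ (-s) + (p : ℂ) ^ ((k : ℂ) - 1 - 2 * s))⁻¹

lemma glAct_sl2ToReal (γ : SL(2, ℤ)) (z : ℍ) : glAct (sl2ToReal γ) z = γ • z := by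
  have hdet : (sl2ToReal γ).det = 1 := by
    have := congrArg (Int.cast : ℤ → ℝ) γ.det_coe
    rw [Matrix.det_fin_two] at this
    simpa [sl2ToReal, Matrix.det_fin_two] using this
  rw [glAct, dif_pos (by rw [hdet]; exact one_pos), ModularGroup.sl_moeb]
  have hg : Matrix.GeneralLinearGroup.mkOfDetNeZero (sl2ToReal γ) (by rw [hdet]; exact one_ne_zero) =
      (γ : GL (Fin 2) ℝ) := by
    ext i j
    rfl
  rw [← hg]
  rfl

open scoped ModularForm in
lemma slash_sl2ToReal (k : ℤ) (γ : SL(2, ℤ)) (f : ℍ → ℂ) :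
    slash k (sl2ToReal γ) f = f ∣[k] γ := by
  have hdet : (sl2ToReal γ).det = 1 := by
    have := congrArg (Int.cast : ℤ → ℝ) γ.det_coe
    rw [Matrix.det_fin_two] at this
    simpa [sl2ToReal, Matrix.det_fin_two] using this
  ext z
  rw [ModularForm.SL_slash_apply, slash, glAct_sl2ToReal, hdet, ModularGroup.denom_apply]
  simp [sl2ToReal, mul_comm]

/-- The lower triangular unipotent matrix with lower left entry `m`. -/
def lowerUnipotent (m : ℤ) : SL(2, ℤ) := ⟨!![1, 0; m, 1], by simp⟩

lemma Int.exists_two_mul_abs_add_mul_le (d : ℤ) {c : ℤ} (hc : c ≠ 0) :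
    ∃ m : ℤ, 2 * |d + m * c| ≤ |c| := by
  have h0 := Int.emod_nonneg d hc
  have h1 := Int.emod_lt_abs d hc
  have h2 := Int.emod_add_mul_ediv d c
  rcases le_or_gt (2 * (d % c)) |c| with h | h
  · refine ⟨-(d / c), ?_⟩
    have : d + -(d / c) * c = d % c := by linarith
    rwa [this, abs_of_nonneg h0]
  · refine ⟨-(d / c) - c.sign, ?_⟩
    have : d + (-(d / c) - c.sign) * c = d % c - |c| := by
      rw [← Int.sign_mul_self_eq_abs]; linarith
    rw [this, abs_of_neg (by linarith)]
    linarith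

lemma exists_abs_lower_left_lt {N : ℤ} (hN1 : 1 ≤ N) (hN4 : N ≤ 4) {a b c d : ℤ}
    (hdet : a * d - b * c = 1) (hc : c ≠ 0) (hNc : N ∣ c) :
    ∃ m n : ℤ, |c + (d + m * c) * (N * n)| < |c| := by
  have hc' : 0 < |c| := abs_pos.mpr hc
  obtain ⟨m, hm⟩ := Int.exists_two_mul_abs_add_mul_le d hc
  have hdet' : a * (d + m * c) - (b + m * a) * c = 1 := by linear_combination hdet
  rcases eq_or_ne (d + m * c) 0 with hd | hd
  · have hcu : c ∣ 1 := ⟨-(b + m * a), by rw [hd] at hdet'; linarith⟩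
    have hNu : N = 1 := Int.eq_one_of_dvd_one (by lia) (hNc.trans hcu)
    refine ⟨m + 1, -1, ?_⟩
    have : c + (d + (m + 1) * c) * (N * -1) = 0 := by rw [hNu]; linarith
    rwa [this, abs_zero]
  · obtain ⟨n, hn⟩ := Int.exists_two_mul_abs_add_mul_le c (mul_ne_zero (by lia : N ≠ 0) hd)
    refine ⟨m, n, ?_⟩
    rw [show (d + m * c) * (N * n) = n * (N * (d + m * c)) by ring]
    generalize d + m * c = e at *
    rw [abs_mul, abs_of_nonneg (by lia : 0 ≤ N)] at hn
    by_contra! hcon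
    have he : 0 < |e| := abs_pos.mpr hd
    have h1 : N * |e| ≤ 4 * |e| := by nlinarith
    have h2 : N * |e| = 4 * |e| := by linarith
    have hN : N = 4 := mul_right_cancel₀ he.ne' h2
    have h3 : 2 * |e| = |c| := by linarith
    have hec : e ∣ c := by
      rw [← abs_dvd_abs]; exact ⟨2, by linarith⟩
    have he1 : e ∣ 1 := by
      rw [← hdet']; exact dvd_sub (dvd_mul_left _ _) (hec.mul_left _)
    have he2 : |e| = 1 := by
      exact Int.isUnit_iff_abs_eq.mp (isUnit_of_dvd_one he1)
    rw [hN, ← dvd_abs, ← h3, he2] at hNc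
    norm_num at hNc

/-- For `1 ≤ N ≤ 4`, the group `Γ₀(N)` is generated by `-1` and two unipotent subgroups. -/
lemma Gamma0_le_of_unipotents_mem {N : ℕ} (hN1 : 1 ≤ N) (hN4 : N ≤ 4) (H : Subgroup SL(2, ℤ))
    (hneg : -1 ∈ H) (hT : ModularGroup.T ∈ H)
    (hL : ∀ m : ℤ, lowerUnipotent (N * m) ∈ H) : CongruenceSubgroup.Gamma0 N ≤ H := by
  intro γ hγ
  rw [CongruenceSubgroup.Gamma0_mem, ZMod.intCast_zmod_eq_zero_iff_dvd] at hγ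
  induction hn : (γ 1 0).natAbs using Nat.strong_induction_on generalizing γ with
  | _ n ih =>
    have hdet := γ.det_coe
    rw [Matrix.det_fin_two] at hdet
    by_cases hc : γ 1 0 = 0
    · rw [hc, mul_zero, sub_zero] at hdet
      rcases Int.mul_eq_one_iff_eq_one_or_neg_one.mp hdet with ⟨h0, h1⟩ | ⟨h0, h1⟩
      · have : γ = ModularGroup.T ^ (γ 0 1) := by
          ext i j
          rw [ModularGroup.coe_T_zpow]
          fin_cases i <;> fin_cases j <;> simp [*]
        rw [this]
        exact H.zpow_mem hT _
      · have : γ = -1 * ModularGroup.T ^ (-γ 0 1) := by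
          ext i j
          rw [neg_one_mul, Matrix.SpecialLinearGroup.coe_neg, ModularGroup.coe_T_zpow]
          fin_cases i <;> fin_cases j <;> simp [*]
        rw [this]
        exact H.mul_mem hneg (H.zpow_mem hT _)
    · obtain ⟨m, l, hml⟩ := exists_abs_lower_left_lt (N := N) (by exact_mod_cast hN1)
        (by exact_mod_cast hN4) hdet hc hγ
      have hentry : (γ * ModularGroup.T ^ m * lowerUnipotent (N * l)) 1 0 =
          γ 1 0 + (γ 1 1 + m * γ 1 0) * (N * l) := by
        rw [Matrix.SpecialLinearGroup.coe_mul, Matrix.SpecialLinearGroup.coe_mul,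
          ModularGroup.coe_T_zpow, lowerUnipotent]
        simp [Matrix.mul_apply, Fin.sum_univ_two]
        left
        ring
      have hlt : (((γ * ModularGroup.T ^ m * lowerUnipotent (N * l) : SL(2, ℤ)) :
          Matrix (Fin 2) (Fin 2) ℤ) 1 0).natAbs < n := by
        rw [Int.abs_eq_natAbs, Int.abs_eq_natAbs] at hml
        rw [hentry, ← hn]
        exact_mod_cast hml
      have hmem := ih _ hlt
        (by rw [hentry]; exact dvd_add hγ ((dvd_mul_right _ _).mul_left _)) rfl
      exact (H.mul_mem_cancel_right (H.zpow_mem hT m)).mp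
        ((H.mul_mem_cancel_right (hL l)).mp hmem)

lemma norm_Gamma_le_Gamma_re {s : ℂ} (hs : 0 < s.re) : ‖Complex.Gamma s‖ ≤ Real.Gamma s.re := by
  rw [Complex.Gamma_eq_integral hs, Real.Gamma_eq_integral hs, Complex.GammaIntegral]
  refine (MeasureTheory.norm_integral_le_integral_norm _).trans_eq ?_
  refine MeasureTheory.setIntegral_congr_fun measurableSet_Ioi fun t ht => ?_
  have ht' : (0 : ℝ) < t := ht
  rw [norm_mul, Complex.norm_cpow_eq_rpow_re_of_pos ht', Complex.norm_real, Real.norm_eq_abs,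
    Real.abs_exp, Complex.sub_re, Complex.one_re]

lemma norm_sq_mul_norm_Gamma_le {s : ℂ} (hs : 0 < s.re) :
    ‖s‖ ^ 2 * ‖Complex.Gamma s‖ ≤ Real.Gamma (s.re + 2) := by
  have h0 : s ≠ 0 := by rintro rfl; simp at hs
  have h1 : s + 1 ≠ 0 := by
    intro h; have := congrArg Complex.re h; simp at this; linarith
  have hle : ‖s‖ ≤ ‖s + 1‖ := by
    rw [← sq_le_sq₀ (norm_nonneg _) (norm_nonneg _), ← Complex.normSq_eq_norm_sq,
      ← Complex.normSq_eq_norm_sq, Complex.normSq_apply, Complex.normSq_apply]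
    simp
    nlinarith
  have h2 : Complex.Gamma (s + 2) = (s + 1) * (s * Complex.Gamma s) := by
    rw [← Complex.Gamma_add_one s h0, ← Complex.Gamma_add_one _ h1]; ring_nf
  have h3 := norm_Gamma_le_Gamma_re (s := s + 2) (by simp; linarith)
  rw [h2, norm_mul, norm_mul] at h3
  have h4 : (s + 2).re = s.re + 2 := by simp
  rw [h4] at h3
  refine le_trans ?_ h3
  rw [sq, mul_assoc]
  gcongr

lemma norm_ofReal_cpow_neg_le {x : ℝ} (hx : 0 < x) (a b : ℝ) :
    ∃ B : ℝ, 0 ≤ B ∧ ∀ s : ℂ, a ≤ s.re → s.re ≤ b → ‖(x : ℂ) ^ (-s)‖ ≤ B := by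
  refine ⟨x ^ (-a) + x ^ (-b), by positivity, fun s ha hb => ?_⟩
  rw [Complex.norm_cpow_eq_rpow_re_of_pos hx, Complex.neg_re]
  have h1 : 0 < x ^ (-a) := by positivity
  have h2 : 0 < x ^ (-b) := by positivity
  rcases le_or_gt 1 x with h | h
  · have := Real.rpow_le_rpow_of_exponent_le h (neg_le_neg ha)
    linarith
  · have := Real.rpow_le_rpow_of_exponent_ge hx h.le (neg_le_neg hb)
    linarith

/-- Quadratic decay on a vertical line gives integrability. -/
lemma integrable_vertical_of_decay {g : ℂ → ℂ} (hg : Continuous g) {σ M : ℝ}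
    (h : ∀ s : ℂ, s.re = σ → ‖s‖ ^ 2 * ‖g s‖ ≤ M) :
    MeasureTheory.Integrable (fun y : ℝ => g (σ + y * Complex.I)) := by
  obtain ⟨B, hB⟩ := (isCompact_Icc (a := (-1 : ℝ)) (b := 1)).exists_bound_of_continuousOn
    (f := fun y : ℝ => g (σ + y * Complex.I)) (by fun_prop)
  have hM : 0 ≤ M := le_trans (by positivity) (h σ (by simp))
  have hB0 : 0 ≤ B := le_trans (norm_nonneg _) (hB 0 (by simp))
  refine (integrable_inv_one_add_sq.const_mul (2 * (B + M))).mono'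
    (by fun_prop : Continuous fun y : ℝ => g (σ + y * Complex.I)).aestronglyMeasurable (.of_forall fun y => ?_)
  rw [← div_eq_mul_inv, le_div_iff₀ (by positivity)]
  by_cases hy : |y| ≤ 1
  · have h1 := hB y (abs_le.mp hy)
    have h2 : y ^ 2 ≤ 1 := (sq_le_one_iff_abs_le_one y).mpr hy
    have h3 := norm_nonneg (g (σ + y * Complex.I))
    nlinarith
  · have h1 := h (σ + y * Complex.I) (by simp)
    have h2 : y ^ 2 ≤ ‖(σ + y * Complex.I : ℂ)‖ ^ 2 := by
      rw [← Complex.normSq_eq_norm_sq, Complex.normSq_apply]; simp; nlinarith [sq_nonneg σ]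
    have h3 : 1 ≤ y ^ 2 := by
      push Not at hy
      exact ((one_lt_sq_iff_one_lt_abs y).mpr hy).le
    have h4 := norm_nonneg (g (σ + y * Complex.I))
    nlinarith [mul_le_mul_of_nonneg_right h2 h4]

lemma integral_vertical_eq_of_decay {g : ℂ → ℂ} (hg : Differentiable ℂ g) {a b M : ℝ} (hab : a ≤ b)
    (h : ∀ s : ℂ, a ≤ s.re → s.re ≤ b → ‖s‖ ^ 2 * ‖g s‖ ≤ M) :
    ∫ y : ℝ, g (a + y * Complex.I) = ∫ y : ℝ, g (b + y * Complex.I) := by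
  have hM : 0 ≤ M := le_trans (by positivity) (h a (by simp) (by simpa))
  have ha := integrable_vertical_of_decay hg.continuous (σ := a) (M := M)
    fun s hs => h s hs.ge (hs.trans_le hab)
  have hb := integrable_vertical_of_decay hg.continuous (σ := b) (M := M)
    fun s hs => h s (hab.trans hs.ge) hs.le
  have hlim (c : ℝ) (hc : MeasureTheory.Integrable (fun y : ℝ => g (c + y * Complex.I))) :=
    MeasureTheory.intervalIntegral_tendsto_integral hc tendsto_neg_atTop_atBot tendsto_id
  have hhor (τ : ℝ → ℝ) (hτ : ∀ T, |τ T| = |T|) :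
      Tendsto (fun T : ℝ => ∫ x : ℝ in a..b, g (x + τ T * Complex.I)) atTop (𝓝 0) := by
    refine squeeze_zero_norm' (a := fun T : ℝ => M / T ^ 2 * |b - a|) ?_ ?_
    · filter_upwards [eventually_gt_atTop 0] with T hT
      refine intervalIntegral.norm_integral_le_of_norm_le_const fun x hx => ?_
      rw [Set.uIoc_of_le hab] at hx
      have h1 := h (x + τ T * Complex.I) (by simpa using hx.1.le) (by simpa using hx.2)
      have h2 : T ^ 2 ≤ ‖(x + τ T * Complex.I : ℂ)‖ ^ 2 := by
        rw [← Complex.normSq_eq_norm_sq, Complex.normSq_apply, ← sq_abs T, ← hτ T, sq_abs]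
        simp
        nlinarith [sq_nonneg x]
      rw [le_div_iff₀ (by positivity), mul_comm]
      exact (mul_le_mul_of_nonneg_right h2 (norm_nonneg _)).trans h1
    · have : Tendsto (fun T : ℝ => M / T ^ 2) atTop (𝓝 0) :=
        tendsto_const_nhds.div_atTop (tendsto_pow_atTop two_ne_zero)
      simpa using this.mul_const |b - a|
  have hrect (T : ℝ) : (∫ x : ℝ in a..b, g (x + (-T : ℝ) * Complex.I)) - (∫ x : ℝ in a..b, g (x + T * Complex.I)) +
      Complex.I • (∫ y : ℝ in (-T)..T, g (b + y * Complex.I)) - Complex.I • (∫ y : ℝ in (-T)..T, g (a + y * Complex.I)) = 0 := by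
    simpa using Complex.integral_boundary_rect_eq_zero_of_differentiableOn g
      (a + (-T : ℝ) * Complex.I) (b + T * Complex.I) hg.differentiableOn
  have hT := (((hhor (fun T => -T) fun T => abs_neg T).sub (hhor id fun T => rfl)).add
    ((hlim b hb).const_smul Complex.I)).sub ((hlim a ha).const_smul Complex.I)
  have := tendsto_nhds_unique hT (tendsto_const_nhds.congr fun T => (hrect T).symm)
  simp only [sub_zero, zero_add, smul_eq_mul] at this
  exact (mul_left_cancel₀ I_ne_zero (sub_eq_zero.mp this)).symm

lemma mellinInv_eq_mellinInv_of_decay {Φ : ℂ → ℂ} (hΦ : Differentiable ℂ Φ) {a b M : ℝ}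
    (hab : a ≤ b) (h : ∀ s : ℂ, a ≤ s.re → s.re ≤ b → ‖s‖ ^ 2 * ‖Φ s‖ ≤ M) {x : ℝ} (hx : 0 < x) :
    mellinInv a Φ x = mellinInv b Φ x := by
  obtain ⟨B, hB0, hB⟩ := norm_ofReal_cpow_neg_le hx a b
  have hx' : (x : ℂ) ≠ 0 := by exact_mod_cast hx.ne'
  have hg : Differentiable ℂ fun s : ℂ => (x : ℂ) ^ (-s) • Φ s :=
    (differentiable_neg.const_cpow (.inl hx')).smul hΦ
  rw [mellinInv, mellinInv, integral_vertical_eq_of_decay hg hab (M := B * M)]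
  intro s hsa hsb
  rw [norm_smul, mul_left_comm]
  exact mul_le_mul (hB s hsa hsb) (h s hsa hsb) (by positivity) hB0

/-- A bounded entire function with quadratic decay on the edges of a strip has quadratic decay
inside. -/
lemma decay_of_decay_on_edges {Φ : ℂ → ℂ} (hΦ : Differentiable ℂ Φ) {a b B M : ℝ} (hab : a < b)
    (hB : ∀ s : ℂ, a ≤ s.re → s.re ≤ b → ‖Φ s‖ ≤ B)
    (ha : ∀ s : ℂ, s.re = a → ‖s‖ ^ 2 * ‖Φ s‖ ≤ M) (hb : ∀ s : ℂ, s.re = b → ‖s‖ ^ 2 * ‖Φ s‖ ≤ M)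
    (s : ℂ) (hsa : a ≤ s.re) (hsb : s.re ≤ b) : ‖s‖ ^ 2 * ‖Φ s‖ ≤ M := by
  have hnorm (s : ℂ) : ‖s ^ 2 * Φ s‖ = ‖s‖ ^ 2 * ‖Φ s‖ := by rw [norm_mul, norm_pow]
  rw [← hnorm]
  refine PhragmenLindelof.vertical_strip (f := fun s => s ^ 2 * Φ s) (a := a) (b := b)
    (by fun_prop : Differentiable ℂ fun s : ℂ => s ^ 2 * Φ s).diffContOnCl ?_
    (fun s hs => (hnorm s).trans_le (ha s hs)) (fun s hs => (hnorm s).trans_le (hb s hs)) hsa hsb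
  have hc : 0 < Real.pi / (b - a) := div_pos Real.pi_pos (sub_pos.mpr hab)
  set c := Real.pi / (b - a) / 2 with hcdef
  have hc0 : 0 < c := by positivity
  refine ⟨c, by rw [hcdef]; linarith, 2 / c, ?_⟩
  set R := |a| + |b| + 1
  refine IsBigO.of_bound (R ^ 2 * B) (Filter.mem_inf_of_right ?_)
  rintro s ⟨h1, h2⟩
  have hBs := hB s h1.le h2.le
  have hR : |s.re| ≤ |a| + |b| := by
    rw [abs_le]; constructor
    · linarith [neg_abs_le a, abs_nonneg b]
    · linarith [le_abs_self b, abs_nonneg a]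
  have hR1 : 1 ≤ R := by simp only [R]; linarith [abs_nonneg a, abs_nonneg b]
  have hsn : ‖s‖ ≤ R * Real.exp |s.im| := by
    have := Complex.norm_le_abs_re_add_abs_im s
    have h3 := Real.add_one_le_exp |s.im|
    have h4 := abs_nonneg s.im
    nlinarith
  have hexp : Real.exp |s.im| ^ 2 ≤ Real.exp (2 / c * Real.exp (c * |s.im|)) := by
    rw [← Real.exp_nat_mul]
    refine Real.exp_le_exp.mpr ?_
    have := Real.add_one_le_exp (c * |s.im|)
    rw [div_mul_eq_mul_div, le_div_iff₀ hc0]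
    push_cast
    nlinarith
  rw [Set.mem_ofPred_eq, hnorm, Real.norm_eq_abs, Real.abs_exp]
  calc ‖s‖ ^ 2 * ‖Φ s‖ ≤ (R * Real.exp |s.im|) ^ 2 * B := by gcongr
    _ = R ^ 2 * B * Real.exp |s.im| ^ 2 := by ring
    _ ≤ _ := by
      have : 0 ≤ B := (norm_nonneg _).trans hBs
      gcongr

/-- Inverse Mellin transforms of a function with a functional equation `Φ s = η Φ (k - s)`. -/
lemma mellinInv_eq_inv_of_functional_equation {Φ : ℂ → ℂ} {k : ℤ} {η : ℂ}
    (hfe : ∀ s, Φ s = η * Φ (k - s)) (σ : ℝ) {x : ℝ} (hx : 0 < x) :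
    mellinInv (k - σ) Φ x = η * (x : ℂ) ^ (-k) * mellinInv σ Φ x⁻¹ := by
  have hx' : (x : ℂ) ≠ 0 := by exact_mod_cast hx.ne'
  have key : ∫ y : ℝ, (x : ℂ) ^ (-(((k - σ : ℝ) : ℂ) + y * Complex.I)) • Φ (((k - σ : ℝ) : ℂ) + y * Complex.I) =
      η * (x : ℂ) ^ (-k) * ∫ y : ℝ, ((x⁻¹ : ℝ) : ℂ) ^ (-(σ + y * Complex.I)) • Φ (σ + y * Complex.I) := by
    rw [← MeasureTheory.integral_neg_eq_self, ← MeasureTheory.integral_const_mul]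
    congr 1 with y
    rw [hfe, ofReal_inv, Complex.inv_cpow _ _ (by
      rw [Complex.arg_ofReal_of_nonneg hx.le]; exact Real.pi_pos.ne), ← Complex.cpow_neg, neg_neg,
      smul_eq_mul, smul_eq_mul]
    have h1 : (k : ℂ) - (((k - σ : ℝ) : ℂ) + ((-y : ℝ) : ℂ) * Complex.I) = σ + y * Complex.I := by
      push_cast; ring
    have h2 : -(((k - σ : ℝ) : ℂ) + ((-y : ℝ) : ℂ) * Complex.I) = ((-k : ℤ) : ℂ) + (σ + y * Complex.I) := by
      push_cast; ring
    rw [h1, h2, Complex.cpow_add _ _ hx', Complex.cpow_intCast]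
    ring
  rw [mellinInv, mellinInv, key, mul_smul_comm]

/-- A power series in `q = exp (2πiz)` without constant term, as a function on `ℂ`. -/
noncomputable def cuspSeries (a : ℕ → ℂ) (z : ℂ) : ℂ :=
  ∑' n : ℕ, a (n + 1) * Complex.exp (2 * (Real.pi : ℂ) * Complex.I * ((n : ℂ) + 1) * z)

lemma exists_norm_le_mul_pow {a : ℕ → ℂ} {C : ℝ}
    (h : (fun n : ℕ => a n) =O[atTop] fun n : ℕ => (n : ℝ) ^ C) :
    ∃ A : ℝ, 0 < A ∧ ∀ n : ℕ, ‖a (n + 1)‖ ≤ A * ((n : ℝ) + 1) ^ ⌈C⌉₊ := by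
  obtain ⟨A, hA, hbd⟩ := bound_of_isBigO_nat_atTop h
  refine ⟨A, hA, fun n => ?_⟩
  have hn : (1 : ℝ) ≤ ((n + 1 : ℕ) : ℝ) := by push_cast; linarith [n.cast_nonneg (α := ℝ)]
  have h1 := hbd (x := n + 1) (Real.rpow_pos_of_pos (by linarith) _).ne'
  rw [Real.norm_of_nonneg (by positivity)] at h1
  refine h1.trans ?_
  rw [← Real.rpow_natCast, ← Nat.cast_succ]
  exact mul_le_mul_of_nonneg_left (Real.rpow_le_rpow_of_exponent_le hn (Nat.le_ceil C)) hA.le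

lemma summable_pow_mul_exp_neg (A : ℝ) (K : ℕ) {c : ℝ} (hc : 0 < c) :
    Summable fun n : ℕ => A * ((n : ℝ) + 1) ^ K * Real.exp (-c * (n + 1)) := by
  have := ((summable_nat_add_iff 1).mpr (Real.summable_pow_mul_exp_neg_nat_mul K hc)).mul_left A
  refine this.congr fun n => ?_
  push_cast
  ring

lemma summable_pow_div_rpow (A : ℝ) (K : ℕ) {c σ : ℝ} (hc : 0 < c) (hσ : K + 1 < σ) :
    Summable fun n : ℕ => A * ((n : ℝ) + 1) ^ K / (c * ((n : ℝ) + 1)) ^ σ := by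
  have := ((summable_nat_add_iff 1).mpr
    (Real.summable_nat_rpow (p := K - σ).mpr (by linarith))).mul_left (A / c ^ σ)
  refine this.congr fun n => ?_
  push_cast
  have hn : (0 : ℝ) < n + 1 := by positivity
  rw [Real.rpow_sub hn, Real.mul_rpow hc.le hn.le, Real.rpow_natCast]
  field_simp

lemma norm_exp_le {n : ℕ} {z : ℂ} {y : ℝ} (hy : y ≤ z.im) :
    ‖Complex.exp (2 * (Real.pi : ℂ) * Complex.I * ((n : ℂ) + 1) * z)‖ ≤
      Real.exp (-(2 * Real.pi * y) * (n + 1)) := by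
  rw [Complex.norm_exp]
  have : (2 * (Real.pi : ℂ) * Complex.I * ((n : ℂ) + 1) * z).re =
      -(2 * Real.pi * z.im) * (n + 1) := by simp; ring
  rw [this]
  gcongr

section

variable {a : ℕ → ℂ} {A : ℝ} {K : ℕ} (ha : ∀ n : ℕ, ‖a (n + 1)‖ ≤ A * ((n : ℝ) + 1) ^ K)

include ha

lemma norm_term_le {z : ℂ} {y : ℝ} (hy : y ≤ z.im) (n : ℕ) :
    ‖a (n + 1) * Complex.exp (2 * (Real.pi : ℂ) * Complex.I * ((n : ℂ) + 1) * z)‖ ≤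
      A * ((n : ℝ) + 1) ^ K * Real.exp (-(2 * Real.pi * y) * (n + 1)) := by
  rw [norm_mul]
  exact mul_le_mul (ha n) (norm_exp_le hy) (norm_nonneg _) ((norm_nonneg _).trans (ha n))

lemma hasSum_cuspSeries {z : ℂ} (hz : 0 < z.im) :
    HasSum (fun n : ℕ => a (n + 1) *
      Complex.exp (2 * (Real.pi : ℂ) * Complex.I * ((n : ℂ) + 1) * z)) (cuspSeries a z) :=
  (Summable.of_norm_bounded (summable_pow_mul_exp_neg A K (by positivity))
    (norm_term_le ha le_rfl)).hasSum

lemma differentiableOn_cuspSeries : DifferentiableOn ℂ (cuspSeries a) {z | 0 < z.im} := by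
  intro z hz
  rw [Set.mem_ofPred_eq] at hz
  have hU : IsOpen {w : ℂ | z.im / 2 < w.im} := isOpen_lt continuous_const Complex.continuous_im
  have := Complex.differentiableOn_tsum_of_summable_norm (U := {w : ℂ | z.im / 2 < w.im})
    (summable_pow_mul_exp_neg A K (c := 2 * Real.pi * (z.im / 2)) (by positivity))
    (F := fun n w => a (n + 1) * Complex.exp (2 * (Real.pi : ℂ) * Complex.I * ((n : ℂ) + 1) * w))
    (fun n => by fun_prop) hU (fun n w hw => norm_term_le ha (le_of_lt hw) n)
  exact (this.differentiableAt (hU.mem_nhds (by simpa using half_lt_self hz))).differentiableWithinAt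

end

lemma cuspSeries_add_intCast (a : ℕ → ℂ) (z : ℂ) (m : ℤ) :
    cuspSeries a (z + m) = cuspSeries a z := by
  refine tsum_congr fun n => ?_
  congr 1
  rw [Complex.exp_eq_exp_iff_exists_int]
  exact ⟨(n + 1) * m, by push_cast; ring⟩

/-- A function majorized by a Dirichlet-type series of exponentials has a convergent Mellin
transform. -/
lemma mellinConvergent_of_hasSum {b : ℕ → ℂ} {A : ℝ} (hA : 0 < A) {K : ℕ}
    (hb : ∀ n : ℕ, ‖b n‖ ≤ A * ((n : ℝ) + 1) ^ K) {c σ : ℝ} (hc : 0 < c) (hσ : K + 1 < σ)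
    {F : ℝ → ℂ} (hcont : ContinuousOn F (Set.Ioi 0))
    (hF : ∀ t ∈ Set.Ioi (0 : ℝ), HasSum (fun n => b n * Real.exp (-(c * ((n : ℝ) + 1)) * t)) (F t)) :
    MellinConvergent F σ := by
  have hσ0 : 0 < σ := by linarith [K.cast_nonneg (α := ℝ)]
  set B : ℕ → ℝ := fun n => A * ((n : ℝ) + 1) ^ K with hB
  have hB0 (n : ℕ) : 0 < B n := by positivity
  set G : ℝ → ℝ := fun t => ∑' n, B n * Real.exp (-(c * ((n : ℝ) + 1)) * t) with hG
  have hGs (t : ℝ) (ht : t ∈ Set.Ioi 0) :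
      HasSum (fun n => B n * Real.exp (-(c * ((n : ℝ) + 1)) * t)) (G t) := by
    have := summable_pow_mul_exp_neg A K (c := c * t) (mul_pos hc ht)
    refine (this.congr fun n => ?_).hasSum
    simp only [hB]
    ring_nf
  have hGm := hasSum_mellin (a := fun n => (B n : ℂ)) (p := fun n => c * ((n : ℝ) + 1))
    (F := fun t => (G t : ℂ)) (s := σ) (fun n => .inr (by positivity)) (by simpa)
    (fun t ht => by exact_mod_cast hGs t ht)
    ((summable_pow_div_rpow A K hc hσ).congr fun n => by
      rw [Complex.norm_real, Real.norm_of_nonneg (hB0 n).le, Complex.ofReal_re])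
  have hterm (n : ℕ) : Complex.Gamma σ * (B n : ℂ) / ((c * ((n : ℝ) + 1) : ℝ) : ℂ) ^ (σ : ℂ) =
      ((Real.Gamma σ * B n / (c * ((n : ℝ) + 1)) ^ σ : ℝ) : ℂ) := by
    rw [Complex.Gamma_ofReal, ← Complex.ofReal_cpow (by positivity)]
    push_cast
    rfl
  have hne : mellin (fun t => (G t : ℂ)) σ ≠ 0 := by
    simp_rw [hterm] at hGm
    have h1 := Complex.hasSum_re hGm
    simp only [Complex.ofReal_re] at h1
    have hpos (n : ℕ) : 0 < Real.Gamma σ * B n / (c * ((n : ℝ) + 1)) ^ σ := by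
      have := Real.Gamma_pos_of_pos hσ0
      have := hB0 n
      positivity
    have h2 := h1.summable.tsum_pos (fun n => (hpos n).le) 0 (hpos 0)
    rw [h1.tsum_eq] at h2
    intro h0
    rw [h0] at h2
    exact lt_irrefl _ h2
  have hGint : MellinConvergent (fun t => (G t : ℂ)) σ :=
    not_imp_comm.mp MeasureTheory.integral_undef hne
  refine MeasureTheory.Integrable.mono hGint ?_ ?_
  · refine ContinuousOn.aestronglyMeasurable (ContinuousOn.fun_smul ?_ hcont) measurableSet_Ioi
    exact fun t ht => (Complex.continuousAt_ofReal_cpow_const t _ (.inr (ne_of_gt ht))).continuousWithinAt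
  · filter_upwards [MeasureTheory.ae_restrict_mem measurableSet_Ioi] with t ht
    rw [norm_smul, norm_smul]
    gcongr
    rw [← (hF t ht).tsum_eq, Complex.norm_real]
    refine (tsum_of_norm_bounded (hGs t ht) fun n => ?_).trans (le_abs_self _)
    rw [norm_mul, Complex.norm_real, Real.norm_eq_abs, Real.abs_exp]
    gcongr
    exact hb n

lemma im_neg_one_div_pos {N : ℝ} (hN : 0 < N) {z : ℂ} (hz : 0 < z.im) :
    0 < (-1 / (N * z) : ℂ).im := by
  have hz0 : z ≠ 0 := by rintro rfl; simp at hz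
  have hN' : (N : ℂ) ≠ 0 := by exact_mod_cast hN.ne'
  have hpos : 0 < Complex.normSq z := Complex.normSq_pos.mpr hz0
  have : -1 / (N * z) = ((N⁻¹ : ℝ) : ℂ) * (-z⁻¹) := by
    push_cast
    field_simp
  rw [this, Complex.im_ofReal_mul, Complex.neg_im, Complex.inv_im, neg_div, neg_neg]
  positivity


section

variable {a : ℕ → ℂ} {A : ℝ} {K : ℕ} (ha : ∀ n : ℕ, ‖a (n + 1)‖ ≤ A * ((n : ℝ) + 1) ^ K)

include ha

lemma hasSum_cuspSeries_mul_I {c t : ℝ} (hc : 0 < c) (ht : 0 < t) :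
    HasSum (fun n : ℕ => a (n + 1) * Real.exp (-(2 * Real.pi * c * ((n : ℝ) + 1)) * t))
      (cuspSeries a (Complex.I * (c * t))) := by
  refine (hasSum_cuspSeries ha (by simpa using mul_pos hc ht)).congr_fun fun n => ?_
  rw [Complex.ofReal_exp]
  congr 2
  push_cast
  linear_combination (-2 * (Real.pi : ℂ) * c * (n + 1) * t) * Complex.I_mul_I

lemma continuousOn_cuspSeries_mul_I {c : ℝ} (hc : 0 < c) :
    ContinuousOn (fun t : ℝ => cuspSeries a (Complex.I * (c * t))) (Set.Ioi 0) :=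
  (differentiableOn_cuspSeries ha).continuousOn.comp (by fun_prop)
    fun t (ht : 0 < t) => by simpa using mul_pos hc ht

lemma mellin_cuspSeries_mul_I {c : ℝ} (hc : 0 < c) {s : ℂ} (hs : K + 1 < s.re) :
    mellin (fun t : ℝ => cuspSeries a (Complex.I * (c * t))) s =
      ((2 * Real.pi * c : ℝ) : ℂ) ^ (-s) * Complex.Gamma s * dirichletSeries a s := by
  have hc' : 0 < 2 * Real.pi * c := by positivity
  have hs0 : 0 < s.re := by linarith [K.cast_nonneg (α := ℝ)]
  have h := hasSum_mellin (a := fun n : ℕ => a (n + 1))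
    (p := fun n => 2 * Real.pi * c * ((n : ℝ) + 1))
    (fun n => .inr (by positivity)) hs0 (fun t ht => hasSum_cuspSeries_mul_I ha hc ht)
    (Summable.of_nonneg_of_le (fun n => by positivity) (fun n => by gcongr; exact ha n)
      (summable_pow_div_rpow A K hc' hs))
  rw [← h.tsum_eq, dirichletSeries, ← tsum_mul_left]
  refine tsum_congr fun n => ?_
  rw [Complex.ofReal_mul, Complex.mul_cpow_ofReal_nonneg hc'.le (by positivity), Complex.cpow_neg]
  push_cast
  field_simp

lemma exists_norm_dirichletSeries_le {σ : ℝ} (hσ : K + 1 < σ) :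
    ∃ D : ℝ, ∀ s : ℂ, s.re = σ → ‖dirichletSeries a s‖ ≤ D := by
  refine ⟨_, fun s hs => tsum_of_norm_bounded (summable_pow_div_rpow A K one_pos hσ).hasSum
    fun n => ?_⟩
  have hn : (0 : ℝ) < n + 1 := by positivity
  have : ‖((n : ℂ) + 1) ^ s‖ = ((n : ℝ) + 1) ^ σ := by
    rw [← hs, ← Complex.norm_cpow_eq_rpow_re_of_pos hn]
    push_cast
    rfl
  rw [norm_div, this, one_mul]
  gcongr
  exact ha n

/-- The functional equation of the completed Dirichlet series gives a transformation law of the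
cusp series on the imaginary axis. -/
lemma cuspSeries_mul_I_eq (hA : 0 < A) {c : ℝ} (hc : 0 < c) {k : ℤ} {η : ℂ} {Φ : ℂ → ℂ} {σ₀ : ℝ}
    (hΦ : Differentiable ℂ Φ)
    (hΦeq : ∀ s : ℂ, σ₀ < s.re →
      Φ s = ((2 * Real.pi * c : ℝ) : ℂ) ^ (-s) * Complex.Gamma s * dirichletSeries a s)
    (hbdd : ∀ σ₁ σ₂ : ℝ, ∃ M : ℝ, ∀ s : ℂ, σ₁ ≤ s.re → s.re ≤ σ₂ → ‖Φ s‖ ≤ M)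
    (hfe : ∀ s : ℂ, Φ s = η * Φ (k - s)) {t : ℝ} (ht : 0 < t) :
    cuspSeries a (Complex.I * (c * t)) =
      η * (t : ℂ) ^ (-k) * cuspSeries a (Complex.I * (c * (t⁻¹ : ℝ))) := by
  have hc' : 0 < 2 * Real.pi * c := by positivity
  obtain ⟨σ, hσ1, hσ2, hσ3⟩ : ∃ σ : ℝ, σ₀ < σ ∧ (K : ℝ) + 1 < σ ∧ |(k : ℝ)| < σ :=
    ⟨max σ₀ (max (K + 1) |(k : ℝ)|) + 1, by linarith [le_max_left σ₀ (max (K + 1 : ℝ) |(k : ℝ)|)],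
      by linarith [le_max_right σ₀ (max (K + 1 : ℝ) |(k : ℝ)|), le_max_left (K + 1 : ℝ) |(k : ℝ)|],
      by linarith [le_max_right σ₀ (max (K + 1 : ℝ) |(k : ℝ)|), le_max_right (K + 1 : ℝ) |(k : ℝ)|]⟩
  have hσ0 : 0 < σ := (abs_nonneg _).trans_lt hσ3
  have hmellin (s : ℂ) (hs : s.re = σ) :
      mellin (fun t : ℝ => cuspSeries a (Complex.I * (c * t))) s = Φ s := by
    rw [mellin_cuspSeries_mul_I ha hc (hs ▸ hσ2), hΦeq s (hs ▸ hσ1)]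
  obtain ⟨M, hM⟩ : ∃ M : ℝ, ∀ s : ℂ, s.re = σ → ‖s‖ ^ 2 * ‖Φ s‖ ≤ M := by
    obtain ⟨D, hD⟩ := exists_norm_dirichletSeries_le ha hσ2
    refine ⟨(2 * Real.pi * c) ^ (-σ) * Real.Gamma (σ + 2) * D, fun s hs => ?_⟩
    rw [hΦeq s (hs ▸ hσ1), norm_mul, norm_mul, Complex.norm_cpow_eq_rpow_re_of_pos hc',
      Complex.neg_re, hs]
    have h1 := norm_sq_mul_norm_Gamma_le (s := s) (hs ▸ hσ0)
    rw [hs] at h1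
    calc ‖s‖ ^ 2 * ((2 * Real.pi * c) ^ (-σ) * ‖Complex.Gamma s‖ * ‖dirichletSeries a s‖)
        = (2 * Real.pi * c) ^ (-σ) * (‖s‖ ^ 2 * ‖Complex.Gamma s‖) * ‖dirichletSeries a s‖ := by ring
      _ ≤ _ := by
        have := hD s hs
        have := Real.Gamma_pos_of_pos (by linarith : 0 < σ + 2)
        gcongr
  have hM' (s : ℂ) (hs : s.re = k - σ) : ‖s‖ ^ 2 * ‖Φ s‖ ≤ 4 * ‖η‖ * M := by
    have hre : (k - s : ℂ).re = σ := by simp [hs]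
    have h1 := hM _ hre
    have h2 : σ ≤ ‖(k - s : ℂ)‖ := hre ▸ Complex.re_le_norm _
    have h3 : ‖(k : ℂ)‖ = |(k : ℝ)| := by simp
    have h4 : ‖s‖ ≤ 2 * ‖(k - s : ℂ)‖ := by
      have := norm_sub_le (k : ℂ) (k - s)
      rw [sub_sub_cancel] at this
      linarith
    rw [hfe, norm_mul]
    calc ‖s‖ ^ 2 * (‖η‖ * ‖Φ (k - s)‖)
        ≤ (2 * ‖(k - s : ℂ)‖) ^ 2 * (‖η‖ * ‖Φ (k - s)‖) := by gcongr
      _ = 4 * ‖η‖ * (‖(k - s : ℂ)‖ ^ 2 * ‖Φ (k - s)‖) := by ring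
      _ ≤ _ := by gcongr
  have hlt : k - σ < σ := by linarith [le_abs_self (k : ℝ)]
  obtain ⟨B, hB⟩ := hbdd (k - σ) σ
  have hdecay := decay_of_decay_on_edges hΦ hlt hB
    (fun s hs => (hM' s hs).trans (le_max_left _ M)) (fun s hs => (hM s hs).trans (le_max_right _ _))
  have hinv {x : ℝ} (hx : 0 < x) : mellinInv σ Φ x = cuspSeries a (Complex.I * (c * x)) := by
    have hcont := continuousOn_cuspSeries_mul_I ha hc
    rw [← mellinInv_mellin_eq σ (fun t : ℝ => cuspSeries a (Complex.I * (c * t))) hx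
      (mellinConvergent_of_hasSum hA ha hc' hσ2 hcont
        fun t ht => hasSum_cuspSeries_mul_I ha hc ht) ?_
      (hcont.continuousAt (Ioi_mem_nhds hx))]
    · simp only [mellinInv]
      congr 2 with y
      rw [hmellin _ (by simp)]
    · have := integrable_vertical_of_decay hΦ.continuous hM
      refine this.congr (.of_forall fun y => ?_)
      exact (hmellin _ (by simp)).symm
  rw [← hinv ht, ← hinv (inv_pos.mpr ht), ← mellinInv_eq_inv_of_functional_equation hfe σ ht,
    mellinInv_eq_mellinInv_of_decay hΦ hlt.le hdecay ht]

/-- A transformation law under `z ↦ -1 / (N z)` on the imaginary axis extends to the upper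
half-plane. -/
lemma cuspSeries_fricke {N : ℝ} (hN : 0 < N) {k : ℤ} {μ : ℂ}
    (h : ∀ t : ℝ, 0 < t → cuspSeries a (-1 / (N * (Complex.I * t))) =
      μ * (Complex.I * t) ^ k * cuspSeries a (Complex.I * t)) {z : ℂ} (hz : 0 < z.im) :
    cuspSeries a (-1 / (N * z)) = μ * z ^ k * cuspSeries a z := by
  have hU : IsOpen {z : ℂ | 0 < z.im} := isOpen_lt continuous_const Complex.continuous_im
  have hne (w : ℂ) (hw : 0 < w.im) : w ≠ 0 := by rintro rfl; simp at hw
  have hN' : (N : ℂ) ≠ 0 := by exact_mod_cast hN.ne'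
  have hF := differentiableOn_cuspSeries ha
  have hmaps : Set.MapsTo (fun w : ℂ => -1 / (N * w)) {z : ℂ | 0 < z.im} {z : ℂ | 0 < z.im} :=
    fun w hw => im_neg_one_div_pos hN hw
  have hdiff : DifferentiableOn ℂ (fun w : ℂ => cuspSeries a (-1 / (N * w)) -
      μ * w ^ k * cuspSeries a w) {z : ℂ | 0 < z.im} := by
    refine (hF.comp ?_ hmaps).sub (DifferentiableOn.mul ?_ hF)
    · exact fun w hw => ((differentiableAt_const _).div (by fun_prop)
        (mul_ne_zero hN' (hne w hw))).differentiableWithinAt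
    · exact fun w hw => ((differentiableAt_zpow.mpr (.inl (hne w hw))).const_mul
        μ).differentiableWithinAt
  have hlim : Tendsto (fun t : ℝ => Complex.I * t) (𝓝[≠] 1) (𝓝[≠] Complex.I) := by
    refine tendsto_nhdsWithin_iff.mpr ⟨?_, ?_⟩
    · have : ContinuousAt (fun t : ℝ => Complex.I * t) 1 := by fun_prop
      simpa using this.tendsto.mono_left nhdsWithin_le_nhds
    · filter_upwards [self_mem_nhdsWithin] with t ht h0
      refine ht ?_
      have := congrArg Complex.im h0
      simpa using this
  have hfreq : ∃ᶠ w in 𝓝[≠] Complex.I, cuspSeries a (-1 / (N * w)) -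
      μ * w ^ k * cuspSeries a w = 0 := by
    refine hlim.frequently (Eventually.frequently ?_)
    filter_upwards [mem_nhdsWithin_of_mem_nhds (Ioi_mem_nhds one_pos)] with t ht
    rw [h t ht, sub_self]
  have := (hdiff.analyticOnNhd hU).eqOn_zero_of_preconnected_of_frequently_eq_zero
    (convex_halfSpace_im_gt 0).isPreconnected (by simp) hfreq hz
  exact sub_eq_zero.mp this

end

/-- Periodicity together with the Fricke involution gives invariance under lower triangular
unipotent matrices. -/
lemma cuspSeries_lowerUnipotent {a : ℕ → ℂ} {N : ℝ} (hN : 0 < N) {k : ℤ} (hk : Even k) {μ : ℂ}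
    (hμ : μ ^ 2 = (N : ℂ) ^ k)
    (h : ∀ z : ℂ, 0 < z.im → cuspSeries a (-1 / (N * z)) = μ * z ^ k * cuspSeries a z)
    (m : ℤ) {z : ℂ} (hz : 0 < z.im) :
    cuspSeries a (z / (N * m * z + 1)) = (N * m * z + 1) ^ k * cuspSeries a z := by
  have hN' : (N : ℂ) ≠ 0 := by exact_mod_cast hN.ne'
  have hz0 : z ≠ 0 := by rintro rfl; simp at hz
  set w : ℂ := -1 / (N * z) + ((-m : ℤ) : ℂ) with hw
  have hw_im : 0 < w.im := by
    rw [hw, Complex.add_im, Complex.intCast_im, add_zero]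
    exact im_neg_one_div_pos hN hz
  have hw_eq : w = -(N * m * z + 1) / (N * z) := by
    rw [hw]
    push_cast
    field_simp
    ring
  have hd : (N * m * z + 1 : ℂ) ≠ 0 := by
    intro h0
    rw [hw_eq, h0] at hw_im
    simp at hw_im
  have h1 : z / (N * m * z + 1) = -1 / (N * w) := by
    rw [hw_eq]
    field_simp
  have h2 : μ * w ^ k * (μ * z ^ k) = (N * m * z + 1) ^ k := by
    calc μ * w ^ k * (μ * z ^ k) = μ ^ 2 * w ^ k * z ^ k := by ring
      _ = (-(N * m * z + 1)) ^ k := by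
        rw [hμ, ← mul_zpow, ← mul_zpow, hw_eq]
        congr 1
        field_simp
      _ = _ := hk.neg_zpow _
  rw [h1, h w hw_im, hw, cuspSeries_add_intCast, ← hw, h z hz, ← mul_assoc, h2]

open scoped ModularForm in
/-- The subgroup of `SL(2, ℤ)` fixing `f` under the weight `k` slash action. -/
def slashStabilizer (k : ℤ) (f : ℍ → ℂ) : Subgroup SL(2, ℤ) where
  carrier := {γ | f ∣[k] γ = f}
  mul_mem' {γ δ} hγ hδ := by
    rw [Set.mem_ofPred_eq] at *
    rw [SlashAction.slash_mul, hγ, hδ]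
  one_mem' := SlashAction.slash_one k f
  inv_mem' {γ} hγ := by
    rw [Set.mem_ofPred_eq] at *
    nth_rw 1 [← hγ]
    rw [← SlashAction.slash_mul, mul_inv_cancel, SlashAction.slash_one]

lemma mem_slashStabilizer {k : ℤ} {f : ℍ → ℂ} {γ : SL(2, ℤ)} :
    γ ∈ slashStabilizer k f ↔
      ∀ z : ℍ, f (γ • z) = ((γ 1 0 : ℂ) * z + (γ 1 1 : ℂ)) ^ k * f z := by
  simp_rw [← ModularForm.slash_action_eq'_iff]
  exact funext_iff

/-- Periodicity and the Fricke involution generate invariance under `Γ₀(N)` for `N ≤ 4`. -/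
lemma Gamma0_le_slashStabilizer {a : ℕ → ℂ} {N : ℕ} (hN1 : 1 ≤ N) (hN4 : N ≤ 4) {k : ℤ}
    (hk : Even k) {μ : ℂ} (hμ : μ ^ 2 = (N : ℂ) ^ k)
    (h : ∀ z : ℂ, 0 < z.im → cuspSeries a (-1 / (N * z)) = μ * z ^ k * cuspSeries a z) :
    CongruenceSubgroup.Gamma0 N ≤ slashStabilizer k (fourierSeries a) := by
  have hf (z : ℍ) : fourierSeries a z = cuspSeries a z := rfl
  refine Gamma0_le_of_unipotents_mem hN1 hN4 _ ?_ ?_ fun m => ?_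
  · rw [mem_slashStabilizer]
    intro z
    rw [ModularGroup.SL_neg_smul, one_smul]
    simp [hk.neg_one_zpow]
  · rw [mem_slashStabilizer]
    intro z
    have := cuspSeries_add_intCast a z 1
    rw [hf, hf, UpperHalfPlane.coe_specialLinearGroup_apply]
    simpa [ModularGroup.T] using this
  · rw [mem_slashStabilizer]
    intro z
    have := cuspSeries_lowerUnipotent (N := N) (by exact_mod_cast hN1) hk hμ
      (by exact_mod_cast h) m z.im_pos
    rw [hf, hf, UpperHalfPlane.coe_specialLinearGroup_apply]
    simpa [lowerUnipotent] using this

/-- **Hecke's converse theorem.** For `N ∈ {1,2,3,4}`: a functional equation of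
degree 2, level `N`, and weight `k` for `F(s) = Σ a_n n^{-s}` forces
`f(z) = Σ a_n e^{2πinz}` to be invariant under `Γ₀(N)`. -/
theorem hecke_converse_theorem
    (N : ℕ) (hN : N ∈ ({1, 2, 3, 4} : Set ℕ))
    (k : ℤ) (hkpos : 0 < k) (hkeven : Even k)
    (a : ℕ → ℂ) (C : ℝ) (hC : 0 < C)
    (hgrowth : (fun n : ℕ => a n) =O[atTop] fun n : ℕ => (n : ℝ) ^ C)
    (ε : ℝ) (hε : ε = 1 ∨ ε = -1)
    (Φ : ℂ → ℂ)
    (hΦentire : Differentiable ℂ Φ)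
    (hΦeq : ∀ s : ℂ, C + 2 < s.re →
      Φ s = ((Real.sqrt N : ℂ) / (2 * (Real.pi : ℂ))) ^ s * Complex.Gamma s *
        dirichletSeries a s)
    (hΦbdd : ∀ σ₁ σ₂ : ℝ, ∃ M : ℝ, ∀ s : ℂ, σ₁ ≤ s.re → s.re ≤ σ₂ → ‖Φ s‖ ≤ M)
    (hΦfe : ∀ s : ℂ, Φ s = (ε : ℂ) * (-1 : ℂ) ^ (k / 2) * Φ ((k : ℂ) - s)) :
    ∀ γ ∈ CongruenceSubgroup.Gamma0 N,
      slash k (sl2ToReal γ) (fourierSeries a) = fourierSeries a := by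
  obtain ⟨A, hA, ha⟩ := exists_norm_le_mul_pow hgrowth
  have hN1 : 1 ≤ N ∧ N ≤ 4 := by
    simp only [Set.mem_insert_iff, Set.mem_singleton_iff] at hN
    lia
  obtain ⟨j, hj⟩ := hkeven.two_dvd
  have hj' : k / 2 = j := by lia
  have hN0 : (0 : ℝ) < N := by exact_mod_cast hN1.1
  have hr : 0 < Real.sqrt N := Real.sqrt_pos.mpr hN0
  have hr' : (Real.sqrt N : ℂ) ≠ 0 := by exact_mod_cast hr.ne'
  have hr2 : (Real.sqrt N : ℂ) ^ 2 = N := by exact_mod_cast Real.sq_sqrt hN0.le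
  set c : ℝ := (Real.sqrt N)⁻¹ with hc_def
  have hc : 0 < c := inv_pos.mpr hr
  have hbase : ((2 * Real.pi * c : ℝ) : ℂ) = ((Real.sqrt N : ℂ) / (2 * (Real.pi : ℂ)))⁻¹ := by
    rw [hc_def]
    push_cast
    field_simp
  have hpow (s : ℂ) : ((2 * Real.pi * c : ℝ) : ℂ) ^ (-s) =
      ((Real.sqrt N : ℂ) / (2 * (Real.pi : ℂ))) ^ s := by
    have harg : ((Real.sqrt N : ℂ) / (2 * (Real.pi : ℂ))).arg ≠ Real.pi := by
      have : (Real.sqrt N : ℂ) / (2 * (Real.pi : ℂ)) =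
        ((Real.sqrt N / (2 * Real.pi) : ℝ) : ℂ) := by push_cast; rfl
      rw [this, Complex.arg_ofReal_of_nonneg (by positivity)]
      exact Real.pi_pos.ne
    rw [hbase, Complex.inv_cpow _ _ harg, ← Complex.cpow_neg, neg_neg]
  have haxis {t : ℝ} (ht : 0 < t) := cuspSeries_mul_I_eq ha hA hc hΦentire (σ₀ := C + 2)
    (fun s hs => by rw [hpow, hΦeq s hs]) hΦbdd hΦfe ht
  have hfricke (t : ℝ) (ht : 0 < t) : cuspSeries a (-1 / (((N : ℝ) : ℂ) * (Complex.I * t))) =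
      ε * (N : ℂ) ^ j * (Complex.I * t) ^ k * cuspSeries a (Complex.I * t) := by
    have ht' : (t : ℂ) ≠ 0 := by exact_mod_cast ht.ne'
    have h := haxis (t := (Real.sqrt N * t)⁻¹) (by positivity)
    have h1 : Complex.I * (c * (((Real.sqrt N * t)⁻¹ : ℝ) : ℂ)) =
        -1 / (((N : ℝ) : ℂ) * (Complex.I * t)) := by
      rw [hc_def]
      push_cast
      rw [← hr2]
      field_simp
      rw [Complex.I_sq]
    have h2 : Complex.I * (c * ((((Real.sqrt N * t)⁻¹)⁻¹ : ℝ) : ℂ)) = Complex.I * t := by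
      rw [hc_def]
      push_cast
      field_simp
    rw [h1, h2] at h
    rw [h, hj', ← hr2, hj]
    push_cast
    rw [_root_.zpow_neg, _root_.inv_zpow, inv_inv, mul_zpow, mul_zpow, _root_.zpow_mul Complex.I,
      _root_.zpow_mul (Real.sqrt N : ℂ)]
    rw [zpow_ofNat, zpow_ofNat Complex.I, Complex.I_sq]
    ring
  have hε2 : (ε : ℂ) ^ 2 = 1 := by
    rcases hε with rfl | rfl <;> simp
  have hmem := Gamma0_le_slashStabilizer (a := a) hN1.1 hN1.2 hkeven (μ := ε * (N : ℂ) ^ j)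
    (by rw [mul_pow, hε2, one_mul, hj, mul_comm 2 j, _root_.zpow_mul]; norm_cast)
    fun z hz => by exact_mod_cast cuspSeries_fricke ha hN0 hfricke hz
  intro γ hγ
  rw [slash_sl2ToReal]
  exact hmem hγ
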